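/- arXiv:1801.08134 — 9 statements merged into one kernel-verified Lean document; each statement's English description precedes it below -/
import Mathlib

section
/- The function f does not satisfy a Lipschitz condition with respect to y on any neighborhood of (0,0): for every L ≥ 0 and all a, b > 0 there exist x ∈ [0,a] and y₁, y₂ ∈ [0,b] with |f(x,y₁) − f(x,y₂)| > L·|y₁ − y₂|. -/
open Set

/-- The piecewise right-hand side of Example 1:
`f(x,y) = x/2` if `y ≤ x²/2`, `f(x,y) = x/2 + 5(y - x²/2)/x` if `x²/2 < y < x²`,
and `f(x,y) = 3x` if `y ≥ x²`.  (For `x = 0` the middle region is empty and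
`f(0,y) = 0` for all `y ≥ 0`.) -/
noncomputable def f (x y : ℝ) : ℝ :=
  if y ≤ x ^ 2 / 2 then x / 2
  else if y < x ^ 2 then x / 2 + 5 * (y - x ^ 2 / 2) / x
  else 3 * x

/-- `f` does not satisfy a Lipschitz condition with respect to `y` on any
neighborhood of `(0,0)`: for every `L ≥ 0` and all `a, b > 0` there exist
`x ∈ [0,a]` and `y₁, y₂ ∈ [0,b]` with `|f(x,y₁) − f(x,y₂)| > L·|y₁ − y₂|`. -/
theorem f_not_lipschitz :
    ∀ L : ℝ, 0 ≤ L → ∀ a b : ℝ, 0 < a → 0 < b →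
      ∃ x ∈ Set.Icc (0:ℝ) a, ∃ y₁ ∈ Set.Icc (0:ℝ) b, ∃ y₂ ∈ Set.Icc (0:ℝ) b,
        L * |y₁ - y₂| < |f x y₁ - f x y₂| := by
  intro L hL a b ha hb
  obtain ⟨x, hx, hxa, hxb, hx1, hxL⟩ :
      ∃ x : ℝ, 0 < x ∧ x ≤ a ∧ x ≤ b ∧ x ≤ 1 ∧ x ≤ 1 / (L + 1) := by
    refine ⟨min (min a b) (min 1 (1 / (L + 1))), by positivity, ?_, ?_, ?_, ?_⟩ <;> simp
  have hLx : x * (L + 1) ≤ 1 := (le_div_iff₀ (by positivity)).mp hxL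
  have hsq : 0 < x ^ 2 := by positivity
  have hsqb : x ^ 2 ≤ b := by nlinarith
  have hupper : f x (x ^ 2) = 3 * x := by
    rw [f, if_neg (by linarith), if_neg (lt_irrefl _)]
  have hlower : f x (x ^ 2 / 2) = x / 2 := by simp [f]
  refine ⟨x, ⟨hx.le, hxa⟩, x ^ 2, ⟨hsq.le, hsqb⟩, x ^ 2 / 2, ⟨by linarith, by linarith⟩, ?_⟩
  rw [hupper, hlower, abs_of_pos (by linarith), abs_of_pos (by linarith)]
  nlinarith
end

section
/- The initial value problem y' = f(x,y), y(0) = 0, has two distinct solutions on [0,∞): there exist differentiable functions φ₁, φ₂ : [0,∞) → ℝ with φ₁(0) = φ₂(0) = 0, φᵢ'(x) = f(x, φᵢ(x)) for all x ≥ 0 (i = 1,2), and φ₁|₍₀,ε₎ ≠ φ₂|₍₀,ε₎ for every ε > 0 (namely φ₁(x) = x²/4 and φ₂(x) = 3x²/2), even though f is continuous and f(x,·) is Lipschitz continuous for every fixed x. -/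
open Set

/-- On the half-plane `0 ≤ x`, `f x` is an affine function truncated to `[x/2, 3x]`. -/
theorem f_eq_max_min {x : ℝ} (hx : 0 ≤ x) (y : ℝ) :
    f x y = max (x / 2) (min (3 * x) (x / 2 + 5 * (y - x ^ 2 / 2) / x)) := by
  unfold f
  rcases hx.eq_or_lt with rfl | hx
  · simp
  split_ifs with h₁ h₂
  · have h : 5 * (y - x ^ 2 / 2) / x ≤ 0 := div_nonpos_of_nonpos_of_nonneg (by linarith) hx.le
    exact (max_eq_left ((min_le_right _ _).trans (by linarith))).symm
  · have h : 0 ≤ 5 * (y - x ^ 2 / 2) / x := div_nonneg (by linarith) hx.le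
    have h' : 5 * (y - x ^ 2 / 2) / x ≤ 5 * x / 2 := by
      rw [div_le_iff₀ hx]
      nlinarith
    rw [min_eq_right (by linarith), max_eq_right (by linarith)]
  · have h : 5 * x / 2 ≤ 5 * (y - x ^ 2 / 2) / x := by
      rw [le_div_iff₀ hx]
      nlinarith
    rw [min_eq_left (by linarith), max_eq_right (by linarith)]

theorem half_le_f {x : ℝ} (hx : 0 ≤ x) (y : ℝ) : x / 2 ≤ f x y := by
  rw [f_eq_max_min hx]
  exact le_max_left _ _

theorem f_le_three_mul {x : ℝ} (hx : 0 ≤ x) (y : ℝ) : f x y ≤ 3 * x := by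
  rw [f_eq_max_min hx]
  exact max_le (by linarith) (min_le_left _ _)

theorem continuousOn_f :
    ContinuousOn (fun p : ℝ × ℝ => f p.1 p.2) (Ici (0 : ℝ) ×ˢ univ) := by
  rintro ⟨a, b⟩ ⟨ha, -⟩
  rcases (mem_Ici.1 ha).eq_or_lt with rfl | ha'
  · have hf : f 0 b = 0 := by simp [f]
    have hlower : ContinuousWithinAt (fun p : ℝ × ℝ => p.1 / 2) (Ici (0 : ℝ) ×ˢ univ) (0, b) := by
      fun_prop
    have hupper : ContinuousWithinAt (fun p : ℝ × ℝ => 3 * p.1) (Ici (0 : ℝ) ×ˢ univ) (0, b) := by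
      fun_prop
    simp only [ContinuousWithinAt, zero_div, mul_zero, hf] at hlower hupper ⊢
    refine tendsto_of_tendsto_of_tendsto_of_le_of_le' hlower hupper ?_ ?_
    · filter_upwards [self_mem_nhdsWithin] with p hp using half_le_f hp.1 _
    · filter_upwards [self_mem_nhdsWithin] with p hp using f_le_three_mul hp.1 _
  · have hcont : ContinuousAt (fun p : ℝ × ℝ =>
        max (p.1 / 2) (min (3 * p.1) (p.1 / 2 + 5 * (p.2 - p.1 ^ 2 / 2) / p.1))) (a, b) := by
      have hdiv : ContinuousAt (fun p : ℝ × ℝ => 5 * (p.2 - p.1 ^ 2 / 2) / p.1) (a, b) :=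
        ContinuousAt.div (by fun_prop) (by fun_prop) ha'.ne'
      fun_prop
    exact hcont.continuousWithinAt.congr (fun p hp => f_eq_max_min hp.1 _) (f_eq_max_min ha _)

theorem abs_f_sub_f_le {x : ℝ} (hx : 0 ≤ x) (y₁ y₂ : ℝ) :
    |f x y₁ - f x y₂| ≤ 5 / x * |y₁ - y₂| := by
  rw [f_eq_max_min hx, f_eq_max_min hx]
  calc
    _ ≤ |(x / 2 + 5 * (y₁ - x ^ 2 / 2) / x) - (x / 2 + 5 * (y₂ - x ^ 2 / 2) / x)| := by
      refine (abs_max_sub_max_le_max _ _ _ _).trans (max_le (by simp) ?_)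
      exact (abs_min_sub_min_le_max _ _ _ _).trans (max_le (by simp) le_rfl)
    _ = |5 / x * (y₁ - y₂)| := by congr 1; ring
    _ = 5 / x * |y₁ - y₂| := by rw [abs_mul, abs_of_nonneg (by positivity : 0 ≤ 5 / x)]

theorem f_sq_div_four (x : ℝ) : f x (x ^ 2 / 4) = x / 2 :=
  if_pos (by nlinarith [sq_nonneg x])

theorem f_three_mul_sq_div_two (x : ℝ) : f x (3 * x ^ 2 / 2) = 3 * x := by
  rcases eq_or_ne x 0 with rfl | hx
  · simp [f]
  · have : 0 < x ^ 2 := by positivity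
    rw [f, if_neg (by linarith), if_neg (by linarith)]

/-- The initial value problem `y' = f(x,y)`, `y(0) = 0` has two distinct
solutions on `[0,∞)` (namely `φ₁(x) = x²/4` and `φ₂(x) = 3x²/2`), even though
`f` is continuous and `f(x,·)` is Lipschitz continuous for every fixed `x`. -/
theorem two_solutions :
    ContinuousOn (fun p : ℝ × ℝ => f p.1 p.2) (Set.Ici (0:ℝ) ×ˢ Set.Ici (0:ℝ)) ∧
    (∀ x : ℝ, 0 ≤ x → ∃ L : ℝ, 0 < L ∧
      ∀ y₁ y₂ : ℝ, 0 ≤ y₁ → 0 ≤ y₂ → |f x y₁ - f x y₂| ≤ L * |y₁ - y₂|) ∧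
    ∃ φ₁ φ₂ : ℝ → ℝ,
      φ₁ = (fun x => x ^ 2 / 4) ∧ φ₂ = (fun x => 3 * x ^ 2 / 2) ∧
      φ₁ 0 = 0 ∧ φ₂ 0 = 0 ∧
      (∀ x : ℝ, 0 ≤ x →
        HasDerivWithinAt φ₁ (f x (φ₁ x)) (Set.Ici (0:ℝ)) x) ∧
      (∀ x : ℝ, 0 ≤ x →
        HasDerivWithinAt φ₂ (f x (φ₂ x)) (Set.Ici (0:ℝ)) x) ∧
      ∀ ε : ℝ, 0 < ε → ¬ Set.EqOn φ₁ φ₂ (Set.Icc (0:ℝ) ε) := by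
  refine ⟨continuousOn_f.mono (prod_mono_right (subset_univ _)), fun x hx => ?_,
    _, _, rfl, rfl, by simp, by simp, fun x _ => ?_, fun x _ => ?_, fun ε hε h => ?_⟩
  · refine ⟨5 / x + 1, by positivity, fun y₁ y₂ _ _ => (abs_f_sub_f_le hx y₁ y₂).trans ?_⟩
    gcongr
    linarith
  · rw [f_sq_div_four]
    refine ((hasDerivAt_pow 2 x).div_const 4).hasDerivWithinAt.congr_deriv ?_
    norm_num
    ring
  · rw [f_three_mul_sq_div_two]
    refine (((hasDerivAt_pow 2 x).const_mul 3).div_const 2).hasDerivWithinAt.congr_deriv ?_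
    norm_num
    ring
  · have hε' : ε ^ 2 / 4 = 3 * ε ^ 2 / 2 := h ⟨hε.le, le_rfl⟩
    nlinarith [pow_pos hε 2]
end

section
/- For every step size h > 0, the explicit Euler iterates for y' = f(x,y), y(0) = 0, defined by x_j = j·h, y₀ = 0, and y_{j+1} = y_j + h·f(x_j, y_j), satisfy 0 ≤ y_j ≤ x_j²/2 for all j ∈ ℕ; in particular f(x_j, y_j) = x_j/2 at every step. -/
open Set

/-- The explicit Euler iterates for `y' = f(x,y)`, `y(0) = 0`, with step size `h`:
`x_j = j·h`, `y₀ = 0`, `y_{j+1} = y_j + h·f(x_j, y_j)`. -/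
noncomputable def eulerY (h : ℝ) : ℕ → ℝ
  | 0 => 0
  | j + 1 => eulerY h j + h * f ((j : ℝ) * h) (eulerY h j)

theorem f_of_le {x y : ℝ} (hy : y ≤ x ^ 2 / 2) : f x y = x / 2 :=
  if_pos hy

theorem eulerY_mem_Icc {h : ℝ} (hh : 0 < h) (j : ℕ) :
    eulerY h j ∈ Icc 0 (((j : ℝ) * h) ^ 2 / 2) := by
  induction j with
  | zero => simp [eulerY]
  | succ j ih =>
    obtain ⟨hnonneg, hle⟩ := ih
    have hprod : 0 ≤ (j : ℝ) * h * h := by positivity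
    rw [eulerY, f_of_le hle]
    push_cast
    constructor <;> nlinarith [sq_nonneg h]

/-- For every step size `h > 0`, the explicit Euler iterates satisfy
`0 ≤ y_j ≤ x_j²/2` for all `j`; in particular `f(x_j, y_j) = x_j/2` at every step. -/
theorem euler_stays_low :
    ∀ h : ℝ, 0 < h → ∀ j : ℕ,
      0 ≤ eulerY h j ∧ eulerY h j ≤ ((j : ℝ) * h) ^ 2 / 2 ∧
      f ((j : ℝ) * h) (eulerY h j) = (j : ℝ) * h / 2 := by
  intro h hh j
  obtain ⟨hnonneg, hle⟩ := eulerY_mem_Icc hh j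
  exact ⟨hnonneg, hle, f_of_le hle⟩
end

section
/- For every step size h > 0, the explicit Euler iterates for y' = f(x,y), y(0) = 0, defined by x_j = j·h, y₀ = 0, y_{j+1} = y_j + h·f(x_j, y_j), are given explicitly by y_j = h²·j·(j−1)/4 = x_j·(x_j − h)/4 for all j ∈ ℕ. -/
open Set

/-- The closed form of the Euler iterates: they stay in the region `y ≤ x²/2`. -/
theorem eulerY_eq (h : ℝ) (j : ℕ) :
    eulerY h j = h ^ 2 * (j : ℝ) * ((j : ℝ) - 1) / 4 := by
  induction j with
  | zero => simp [eulerY]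
  | succ j ih =>
    have hle : eulerY h j ≤ ((j : ℝ) * h) ^ 2 / 2 := by
      have hj : 0 ≤ h ^ 2 * (j : ℝ) := by positivity
      have hj' : 0 ≤ h ^ 2 * (j : ℝ) ^ 2 := by positivity
      rw [ih]
      linarith
    rw [eulerY, f, if_pos hle, ih]
    push_cast
    ring

/-- For every step size `h > 0`, the explicit Euler iterates are given explicitly by
`y_j = h²·j·(j−1)/4 = x_j·(x_j − h)/4` for all `j ∈ ℕ`, where `x_j = j·h`. -/
theorem euler_explicit_formula :
    ∀ h : ℝ, 0 < h → ∀ j : ℕ,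
      eulerY h j = h ^ 2 * (j : ℝ) * ((j : ℝ) - 1) / 4 ∧
      eulerY h j = ((j : ℝ) * h) * ((j : ℝ) * h - h) / 4 := by
  intro h _ j
  refine ⟨eulerY_eq h j, ?_⟩
  rw [eulerY_eq]
  ring
end

section
/- For every step size h with 0 < h ≤ 1, the modified (pushed) Euler iterates defined by x_j = j·h, y₀ = 0, y₁ = y₀ + K·h with K = 1, and y_{j+1} = y_j + h·f(x_j, y_j) for j ≥ 1, satisfy y_j ≥ x_j² for all j ≥ 1; in particular f(x_j, y_j) = 3x_j at every step j ≥ 1. -/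
open Set

/-- The pushed Euler iterates (PushEuler with push constant `K = 1`) for
`y' = f(x,y)`, `y(0) = 0`, with step size `h`:
`x_j = j·h`, `y₀ = 0`, `y₁ = y₀ + K·h = h`, and `y_{j+1} = y_j + h·f(x_j, y_j)` for `j ≥ 1`. -/
noncomputable def pushY (h : ℝ) : ℕ → ℝ
  | 0 => 0
  | 1 => h
  | j + 2 => pushY h (j + 1) + h * f (((j : ℝ) + 1) * h) (pushY h (j + 1))

theorem f_of_sq_le {x y : ℝ} (hx : 0 < x) (hy : x ^ 2 ≤ y) : f x y = 3 * x := by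
  have hx2 : 0 < x ^ 2 := by positivity
  rw [f, if_neg (by linarith), if_neg (by linarith)]

theorem sq_le_pushY_succ {h : ℝ} (h0 : 0 < h) (h1 : h ≤ 1) (j : ℕ) :
    (((j : ℝ) + 1) * h) ^ 2 ≤ pushY h (j + 1) := by
  induction j with
  | zero =>
    simp only [pushY, Nat.cast_zero]
    nlinarith
  | succ j ih =>
    rw [pushY, f_of_sq_le (by positivity) ih]
    push_cast
    have hj : 0 ≤ (j : ℝ) * h ^ 2 := by positivity
    linarith

/-- For every step size `0 < h ≤ 1`, the pushed Euler iterates with `K = 1`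
satisfy `y_j ≥ x_j²` for all `j ≥ 1`; in particular `f(x_j, y_j) = 3x_j`
at every step `j ≥ 1`. -/
theorem pushEuler_stays_high :
    ∀ h : ℝ, 0 < h → h ≤ 1 → ∀ j : ℕ, 1 ≤ j →
      ((j : ℝ) * h) ^ 2 ≤ pushY h j ∧
      f ((j : ℝ) * h) (pushY h j) = 3 * ((j : ℝ) * h) := by
  intro h h0 h1 j hj
  obtain ⟨k, rfl⟩ := Nat.exists_eq_add_of_le' hj
  have hk := sq_le_pushY_succ h0 h1 k
  rw [Nat.cast_add_one]
  exact ⟨hk, f_of_sq_le (by positivity) hk⟩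
end

section
/- For every step size h with 0 < h ≤ 1, the pushed Euler iterates with K = 1 are given explicitly by y_j = h + 3h²·j·(j−1)/2 = h + 3·x_j·(x_j − h)/2 for all j ≥ 1, where x_j = j·h. -/
open Set

/-- On or above the parabola `y = x²` the right-hand side is `3x`. -/
theorem f_eq_three_mul {x y : ℝ} (hx : x ≠ 0) (hy : x ^ 2 ≤ y) : f x y = 3 * x := by
  have hpos : 0 < x ^ 2 := by positivity
  rw [f, if_neg (by linarith), if_neg hy.not_gt]

theorem Nat.cast_mul_cast_sub_one_nonneg (n : ℕ) : 0 ≤ (n : ℝ) * ((n : ℝ) - 1) := by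
  rcases n with _ | n
  · simp
  · push_cast
    rw [add_sub_cancel_right]
    positivity

theorem pushY_succ {h : ℝ} (h0 : 0 < h) (h1 : h ≤ 1) (n : ℕ) :
    pushY h (n + 1) = h + 3 * h ^ 2 * ((n : ℝ) + 1) * n / 2 := by
  induction n with
  | zero => simp [pushY]
  | succ n ih =>
    have habove : (((n : ℝ) + 1) * h) ^ 2 ≤ pushY h (n + 1) := by
      rw [ih]
      nlinarith [mul_nonneg (sq_nonneg h) (Nat.cast_mul_cast_sub_one_nonneg n),
        mul_nonneg h0.le (sub_nonneg.2 h1)]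
    rw [pushY, f_eq_three_mul (by positivity) habove, ih]
    push_cast
    ring

/-- For every step size `0 < h ≤ 1`, the pushed Euler iterates with `K = 1` are
given explicitly by `y_j = h + 3h²·j·(j−1)/2 = h + 3·x_j·(x_j − h)/2` for all
`j ≥ 1`, where `x_j = j·h`. -/
theorem pushEuler_explicit_formula :
    ∀ h : ℝ, 0 < h → h ≤ 1 → ∀ j : ℕ, 1 ≤ j →
      pushY h j = h + 3 * h ^ 2 * (j : ℝ) * ((j : ℝ) - 1) / 2 ∧
      pushY h j = h + 3 * ((j : ℝ) * h) * ((j : ℝ) * h - h) / 2 := by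
  intro h h0 h1 j hj
  obtain ⟨n, rfl⟩ := Nat.exists_eq_add_of_le' hj
  rw [pushY_succ h0 h1]
  push_cast
  constructor <;> ring
end

section
/- The function F : [−1,1] × ℝ → ℝ defined by F(x,y) = 0 if x < 0, F(x,y) = x/2 if x ≥ 0 and y < 0, and F(x,y) = f(x,y) if x ≥ 0 and y ≥ 0 (where f is the piecewise function of Example 1) is continuous. -/
open Set

/-- The extension `F : [−1,1] × ℝ → ℝ`:
`F(x,y) = 0` if `x < 0`; `F(x,y) = x/2` if `x ≥ 0` and `y < 0`;
`F(x,y) = f(x,y)` if `x ≥ 0` and `y ≥ 0`. -/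
noncomputable def F (x y : ℝ) : ℝ :=
  if x < 0 then 0 else if y < 0 then x / 2 else f x y

theorem F_eq_clamp {x : ℝ} (hx : 0 < x) (y : ℝ) :
    F x y = x / 2 + 5 * max 0 (min (y - x ^ 2 / 2) (x ^ 2 / 2)) / x := by
  have hx2 : 0 < x ^ 2 := by positivity
  unfold F f
  rw [if_neg hx.not_gt]
  split_ifs with h₀ h₁ h₂
  · rw [max_eq_left ((min_le_left _ _).trans (by linarith))]
    simp
  · rw [max_eq_left ((min_le_left _ _).trans (by linarith))]
    simp
  · rw [min_eq_left (by linarith), max_eq_right (by linarith)]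
  · rw [min_eq_right (by linarith), max_eq_right (by linarith)]
    field_simp
    norm_num

theorem abs_F_le (x y : ℝ) : |F x y| ≤ 3 * |x| := by
  rcases lt_or_ge 0 x with hx | hx
  · have hx2 : 0 < x ^ 2 := by positivity
    set c := max 0 (min (y - x ^ 2 / 2) (x ^ 2 / 2)) with hc
    have hc₀ : 0 ≤ c := le_max_left _ _
    have hc₁ : c ≤ x ^ 2 / 2 := max_le (by positivity) (min_le_right _ _)
    have hq : 5 * c / x ≤ 5 * x / 2 := by
      rw [div_le_iff₀ hx]
      nlinarith
    have hq₀ : 0 ≤ 5 * c / x := by positivity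
    rw [F_eq_clamp hx, ← hc, abs_of_pos hx, abs_of_nonneg (by positivity)]
    linarith
  · rcases hx.lt_or_eq with hx | rfl
    · simp [F, hx]
    · simp [F, f]

theorem F_continuous : Continuous (fun p : ℝ × ℝ => F p.1 p.2) := by
  rw [continuous_iff_continuousAt]
  rintro ⟨x, y⟩
  rcases lt_trichotomy x 0 with hx | rfl | hx
  · have h : ∀ᶠ p : ℝ × ℝ in nhds (x, y), F p.1 p.2 = 0 := by
      filter_upwards [continuous_fst.continuousAt.eventually_lt_const hx] with p hp
      exact if_pos hp
    exact continuousAt_const.congr (h.mono fun _ hp => hp.symm)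
  · have h₀ : F 0 y = 0 := by simp [F, f]
    unfold ContinuousAt
    simp only [h₀]
    refine squeeze_zero_norm (fun p => abs_F_le p.1 p.2) ?_
    have : Continuous fun p : ℝ × ℝ => 3 * |p.1| := by fun_prop
    simpa using this.tendsto (0, y)
  · have h : ∀ᶠ p : ℝ × ℝ in nhds (x, y), F p.1 p.2 =
        p.1 / 2 + 5 * max 0 (min (p.2 - p.1 ^ 2 / 2) (p.1 ^ 2 / 2)) / p.1 := by
      filter_upwards [continuous_fst.continuousAt.eventually_const_lt hx] with p hp
      exact F_eq_clamp hp p.2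
    refine ContinuousAt.congr ?_ (h.mono fun _ hp => hp.symm)
    exact ContinuousAt.add (by fun_prop)
      (ContinuousAt.div (by fun_prop) (by fun_prop) (ne_of_gt hx))

/-- The function `F` is continuous on `[−1,1] × ℝ`. -/
theorem F_continuousOn :
    ContinuousOn (fun p : ℝ × ℝ => F p.1 p.2) (Set.Icc (-1:ℝ) 1 ×ˢ Set.univ) :=
  F_continuous.continuousOn
end

section
/- The function ψ₁ : [−1,1] → ℝ given by ψ₁(x) = x²/4 for x ≥ 0 and ψ₁(x) = 0 for x < 0 is differentiable on [−1,1], satisfies ψ₁(0) = 0, and solves ψ₁'(x) = F(x, ψ₁(x)) for all x ∈ [−1,1]. -/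
open Set

/-- Along the graph of `ψ₁`, which lies below `y = x²/2`, the right-hand side `F` is `x/2` for
`x ≥ 0` and `0` for `x < 0`. -/
lemma F_psi1 (x : ℝ) :
    F x (if x < 0 then 0 else x ^ 2 / 4) = if x < 0 then 0 else x / 2 := by
  by_cases hx : x < 0
  · simp [F, hx]
  · have hneg : ¬ x ^ 2 / 4 < 0 := not_lt.mpr (by positivity)
    have hle : x ^ 2 / 4 ≤ x ^ 2 / 2 := by linarith [sq_nonneg x]
    simp only [F, f, if_neg hx, if_neg hneg, if_pos hle]

lemma hasDerivAt_sq_div_four (x : ℝ) : HasDerivAt (fun x : ℝ => x ^ 2 / 4) (x / 2) x :=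
  ((hasDerivAt_pow 2 x).div_const 4).congr_deriv (by push_cast; ring)

lemma hasDerivAt_psi1 (x : ℝ) :
    HasDerivAt (fun x : ℝ => if x < 0 then 0 else x ^ 2 / 4) (if x < 0 then 0 else x / 2) x := by
  rcases lt_trichotomy x 0 with hx | rfl | hx
  · rw [if_pos hx]
    refine (hasDerivAt_const x (0 : ℝ)).congr_of_eventuallyEq ?_
    filter_upwards [Iio_mem_nhds hx] with y hy using if_pos hy
  · rw [if_neg (lt_irrefl 0), ← hasDerivWithinAt_univ, ← Iio_union_Ici (a := (0 : ℝ))]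
    refine HasDerivWithinAt.union ?_ ?_
    · rw [zero_div]
      exact (hasDerivWithinAt_const 0 _ (0 : ℝ)).congr (fun y hy => if_pos hy) (by simp)
    · exact (hasDerivAt_sq_div_four 0).hasDerivWithinAt.congr
        (fun y hy => if_neg (not_lt.mpr hy)) (by simp)
  · rw [if_neg hx.not_gt]
    refine (hasDerivAt_sq_div_four x).congr_of_eventuallyEq ?_
    filter_upwards [Ioi_mem_nhds hx] with y hy using if_neg (not_lt.mpr (le_of_lt hy))

/-- `ψ₁(x) = x²/4` for `x ≥ 0`, `ψ₁(x) = 0` for `x < 0`, is differentiable on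
`[−1,1]`, satisfies `ψ₁(0) = 0`, and solves `ψ₁'(x) = F(x, ψ₁(x))` on `[−1,1]`. -/
theorem psi1_solves :
    (fun x : ℝ => if x < 0 then 0 else x ^ 2 / 4) 0 = 0 ∧
    ∀ x ∈ Set.Icc (-1:ℝ) 1,
      HasDerivWithinAt (fun x : ℝ => if x < 0 then 0 else x ^ 2 / 4)
        (F x ((fun x : ℝ => if x < 0 then 0 else x ^ 2 / 4) x))
        (Set.Icc (-1:ℝ) 1) x := by
  refine ⟨by simp, fun x _ => ?_⟩
  rw [F_psi1]
  exact (hasDerivAt_psi1 x).hasDerivWithinAt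
end

section
/- The function ψ₂ : [−1, (2/3)^{1/2}] → ℝ given by ψ₂(x) = 3x²/2 for x ≥ 0 and ψ₂(x) = 0 for x < 0 is differentiable on its domain, satisfies ψ₂(0) = 0 and |ψ₂(x)| ≤ 1, and solves ψ₂'(x) = F(x, ψ₂(x)) for all x ∈ [−1, (2/3)^{1/2}]. -/
open Set

/-- Along `y = 3x²/2` with `x ≥ 0` the right-hand side `F` takes the value `3x`. -/
lemma F_parabola {x : ℝ} (hx : 0 ≤ x) : F x (3 * x ^ 2 / 2) = 3 * x := by
  have hsq : 0 ≤ x ^ 2 := sq_nonneg x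
  rw [F, if_neg hx.not_gt, if_neg (by linarith), f]
  split_ifs with h₁ h₂
  · have : x = 0 := pow_eq_zero_iff two_ne_zero |>.mp (by linarith)
    simp [this]
  · linarith
  · rfl

lemma hasDerivAt_parabola (x : ℝ) : HasDerivAt (fun x : ℝ => 3 * x ^ 2 / 2) (3 * x) x := by
  refine (((hasDerivAt_pow 2 x).const_mul 3).div_const 2).congr_deriv ?_
  norm_num
  ring

lemma hasDerivAt_half_parabola (x : ℝ) :
    HasDerivAt (fun x : ℝ => if x < 0 then 0 else 3 * x ^ 2 / 2)
      (if x < 0 then 0 else 3 * x) x := by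
  rcases lt_trichotomy x 0 with hx | rfl | hx
  · rw [if_pos hx]
    refine (hasDerivAt_const x (0 : ℝ)).congr_of_eventuallyEq ?_
    filter_upwards [Iio_mem_nhds hx] with y hy
    exact if_pos hy
  · rw [if_neg (lt_irrefl 0), mul_zero, ← hasDerivWithinAt_univ, ← Iic_union_Ici (a := (0 : ℝ))]
    refine HasDerivWithinAt.union ?_ ?_
    · refine (hasDerivWithinAt_const (0 : ℝ) (Iic 0) (0 : ℝ)).congr (fun y hy => ?_) (by simp)
      rcases (mem_Iic.mp hy).lt_or_eq with h | rfl
      · exact if_pos h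
      · simp
    · have h := (hasDerivAt_parabola 0).hasDerivWithinAt (s := Ici 0)
      rw [mul_zero] at h
      exact h.congr (fun y hy => if_neg (mem_Ici.mp hy).not_gt) (by simp)
  · rw [if_neg hx.not_gt]
    refine (hasDerivAt_parabola x).congr_of_eventuallyEq ?_
    filter_upwards [Ioi_mem_nhds hx] with y hy
    exact if_neg (mem_Ioi.mp hy).not_gt

/-- `ψ₂(x) = 3x²/2` for `x ≥ 0`, `ψ₂(x) = 0` for `x < 0`, is differentiable on
`[−1,(2/3)^{1/2}]`, satisfies `ψ₂(0) = 0` and `|ψ₂(x)| ≤ 1`, and solves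
`ψ₂'(x) = F(x, ψ₂(x))` on `[−1,(2/3)^{1/2}]`. -/
theorem psi2_solves :
    (fun x : ℝ => if x < 0 then 0 else 3 * x ^ 2 / 2) 0 = 0 ∧
    ∀ x ∈ Set.Icc (-1:ℝ) (Real.sqrt (2 / 3)),
      |(fun x : ℝ => if x < 0 then 0 else 3 * x ^ 2 / 2) x| ≤ 1 ∧
      HasDerivWithinAt (fun x : ℝ => if x < 0 then 0 else 3 * x ^ 2 / 2)
        (F x ((fun x : ℝ => if x < 0 then 0 else 3 * x ^ 2 / 2) x))
        (Set.Icc (-1:ℝ) (Real.sqrt (2 / 3))) x := by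
  refine ⟨by simp, fun x hx => ⟨?_, ?_⟩⟩
  · rcases lt_or_ge x 0 with h | h
    · simp [h]
    · have hsq : x ^ 2 ≤ 2 / 3 := (Real.le_sqrt h (by norm_num)).mp hx.2
      simp only [if_neg h.not_gt]
      rw [abs_of_nonneg (by positivity)]
      linarith
  · refine (hasDerivAt_half_parabola x).hasDerivWithinAt.congr_deriv ?_
    rcases lt_or_ge x 0 with h | h
    · simp [F, h]
    · simpa only [if_neg h.not_gt] using (F_parabola h).symm
end
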